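/- Let P and Q be real polynomials with Q ≠ 0 and deg P < deg Q, and suppose Q is not squarefree. Let Q₁ = gcd(Q, Q′) (the greatest common divisor of Q and its formal derivative) and Q₂ = Q / Q₁. Then there exist real polynomials P₁ and P₂ with deg P₁ < deg Q₁ and deg P₂ < deg Q₂ such that, in the field of rational functions ℝ(x), P/Q = (P₁/Q₁)′ + P₂/Q₂, where (P₁/Q₁)′ denotes the formal derivative of the rational function P₁/Q₁. -/

import Mathlib

open Polynomial

section

variable {k : Type*} [Field k]

/-- Dividing `Q` by a multiple of all common divisors of `Q` and `Q'` leaves a squarefree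
quotient. -/
theorem squarefree_of_mul_eq_of_dvd [DecidableEq k] {Q Q₁ Q₂ : k[X]} (hQ : Q ≠ 0)
    (hmul : Q₁ * Q₂ = Q) (hdvd : ∀ d : k[X], d ∣ Q → d ∣ derivative Q → d ∣ Q₁) :
    Squarefree Q₂ := by
  have h : EuclideanDomain.divRadical Q ∣ Q₁ :=
    hdvd _ (EuclideanDomain.divRadical_dvd_self Q) (divRadical_dvd_derivative Q)
  refine UniqueFactorizationMonoid.squarefree_radical.squarefree_of_dvd
    (y := UniqueFactorizationMonoid.radical Q) ?_
  obtain ⟨c, hc⟩ := h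
  refine ⟨c, mul_left_cancel₀ (EuclideanDomain.divRadical_ne_zero hQ) ?_⟩
  rw [EuclideanDomain.divRadical_mul_radical, ← mul_assoc, mul_right_comm, ← hc, hmul]

variable [CharZero k]

/-- A reduced fraction whose derivative has a squarefree denominator is a polynomial. -/
theorem isUnit_of_sq_dvd_mul_wronskian {A B S : k[X]} (hB : B ≠ 0) (hS : Squarefree S)
    (hAB : IsCoprime A B) (h : B ^ 2 ∣ S * (derivative A * B - A * derivative B)) :
    IsUnit B := by
  by_contra hu
  obtain ⟨p, hp, hpB⟩ := WfDvdMonoid.exists_irreducible_factor hu hB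
  have hpA : ¬ p ∣ A := fun hpA => hp.not_isUnit (hAB.isUnit_of_dvd' hpA hpB)
  have hp' : ¬ p ∣ derivative p := fun hd =>
    hp.not_isUnit (hp.separable.isUnit_of_dvd' dvd_rfl hd)
  obtain ⟨n, C, hC, rfl⟩ := WfDvdMonoid.max_power_factor hB hp
  obtain _ | n := n
  · exact hC (by simpa using hpB)
  have hX : ¬ p ∣ derivative A * p * C
      - A * ((n + 1 : k[X]) * derivative p * C + p * derivative C) := by
    intro hX
    have h1 : p ∣ A * (n + 1 : k[X]) * derivative p * C := by
      convert (dvd_mul_right p (derivative A * C - A * derivative C)).sub hX using 1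
      ring
    have hn : ¬ p ∣ (n + 1 : k[X]) := by
      intro hd
      refine hp.not_isUnit (isUnit_of_dvd_unit hd ?_)
      have : IsUnit (Polynomial.C (n + 1 : k)) := isUnit_C.2 (Nat.cast_add_one_ne_zero n).isUnit
      simpa using this
    rcases hp.prime.dvd_or_dvd h1 with h1 | h1
    · rcases hp.prime.dvd_or_dvd h1 with h1 | h1
      · rcases hp.prime.dvd_or_dvd h1 with h1 | h1
        exacts [hpA h1, hn h1]
      · exact hp' h1
    · exact hC h1
  have h2 : p ^ 2 ∣ S * (derivative A * p * C
      - A * ((n + 1 : k[X]) * derivative p * C + p * derivative C)) := by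
    obtain ⟨D, hD⟩ := h
    refine ⟨p ^ n * C ^ 2 * D, mul_left_cancel₀ (pow_ne_zero n hp.ne_zero) ?_⟩
    simp only [derivative_mul, derivative_pow, Nat.add_sub_cancel, Nat.cast_add, Nat.cast_one,
      map_add, map_natCast, map_one] at hD
    linear_combination hD
  have h3 := hp.prime.pow_dvd_of_dvd_mul_right 2 hX h2
  exact hp.not_isUnit (hS p (by rwa [← sq]))

/-- If the derivative of `P / Q` has a squarefree denominator, then `P / Q` is a polynomial. -/
theorem dvd_of_sq_dvd_mul_wronskian {P Q S : k[X]} (hQ : Q ≠ 0) (hS : Squarefree S)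
    (h : Q ^ 2 ∣ S * (derivative P * Q - P * derivative Q)) : Q ∣ P := by
  classical
  obtain ⟨A, B, hA, hB, hu⟩ := extract_gcd P Q
  set g := gcd P Q
  have hg : g ≠ 0 := by rintro h0; simp [h0] at hB; exact hQ hB
  have hB0 : B ≠ 0 := by rintro rfl; simp at hB; exact hQ hB
  have hunit : IsUnit B := by
    refine isUnit_of_sq_dvd_mul_wronskian hB0 hS ((gcd_isUnit_iff A B).1 hu) ?_
    refine (mul_dvd_mul_iff_left (pow_ne_zero 2 hg)).1 ?_
    convert h using 1
    · rw [hB]; ring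
    · rw [hA, hB, derivative_mul, derivative_mul]; ring
  rw [hA, hB]
  exact mul_dvd_mul_left g hunit.dvd

/-- Existence of the Ostrogradsky decomposition with the denominators cleared. -/
theorem exists_hermite_reduction {P Q₁ Q₂ T : k[X]} (h₁ : Q₁ ≠ 0) (hS : Squarefree Q₂)
    (hT : derivative Q₁ * Q₂ = Q₁ * T) (hP : P.degree < (Q₁ * Q₂).degree) :
    ∃ P₁ P₂ : k[X], P₁.degree < Q₁.degree ∧ P₂.degree < Q₂.degree ∧
      P = derivative P₁ * Q₂ - P₁ * T + P₂ * Q₁ := by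
  have h₂ : Q₂ ≠ 0 := hS.ne_zero
  have hd₁ := degree_eq_natDegree h₁
  have hd₂ := degree_eq_natDegree h₂
  have hTdeg : T.degree < Q₂.degree := by
    have h := congrArg degree hT
    rw [degree_mul, degree_mul] at h
    have h' := WithBot.add_lt_add_right (degree_ne_bot.2 h₂) (degree_derivative_lt h₁)
    rw [h] at h'
    exact lt_of_add_lt_add_left h'
  let f : (k[X] × k[X]) →ₗ[k] k[X] :=
    (LinearMap.mulRight k Q₂ ∘ₗ derivative - LinearMap.mulRight k T).coprod
      (LinearMap.mulRight k Q₁)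
  have hf (x : k[X] × k[X]) : f x = derivative x.1 * Q₂ - x.1 * T + x.2 * Q₁ := by
    simp [f]
  let V := degreeLT k Q₁.natDegree
  let W := degreeLT k Q₂.natDegree
  let U := degreeLT k (Q₁.natDegree + Q₂.natDegree)
  have hfin (n : ℕ) : FiniteDimensional k (degreeLT k n) :=
    (degreeLTEquiv k n).symm.finiteDimensional
  have hrank (n : ℕ) : Module.finrank k (degreeLT k n) = n := by
    simp [(degreeLTEquiv k n).finrank_eq]
  have hmaps (x : V × W) : (f ∘ₗ V.subtype.prodMap W.subtype) x ∈ U := by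
    obtain ⟨⟨a, ha⟩, ⟨b, hb⟩⟩ := x
    simp only [V, W, mem_degreeLT, ← hd₁, ← hd₂] at ha hb
    have hmul {p q : k[X]} (hp : p.degree < Q₁.degree) (hq : q.degree ≤ Q₂.degree) :
        (p * q).degree < Q₁.degree + Q₂.degree := by
      rw [degree_mul]
      exact lt_of_le_of_lt (by gcongr) (WithBot.add_lt_add_right (degree_ne_bot.2 h₂) hp)
    have hU {p : k[X]} : p ∈ U ↔ p.degree < Q₁.degree + Q₂.degree := by
      rw [mem_degreeLT, hd₁, hd₂, Nat.cast_add]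
    have hb' : b * Q₁ ∈ U := by
      rw [hU, degree_mul, add_comm]
      exact WithBot.add_lt_add_left (degree_ne_bot.2 h₁) hb
    have ha' : derivative a * Q₂ ∈ U := hU.2 (hmul (degree_derivative_le.trans_lt ha) le_rfl)
    have haT : a * T ∈ U := hU.2 (hmul ha hTdeg.le)
    simpa [hf] using U.add_mem (U.sub_mem ha' haT) hb'
  let g : (V × W) →ₗ[k] U := (f ∘ₗ V.subtype.prodMap W.subtype).codRestrict U hmaps
  have hg (x : V × W) :
      (g x : k[X]) = derivative (x.1 : k[X]) * Q₂ - x.1 * T + x.2 * Q₁ := by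
    simp [g, hf]
  have hinj : Function.Injective g := by
    refine (injective_iff_map_eq_zero g).2 ?_
    rintro ⟨⟨a, ha⟩, ⟨b, hb⟩⟩ hx
    have hx' := hg ⟨⟨a, ha⟩, ⟨b, hb⟩⟩
    simp only [hx, Submodule.coe_zero] at hx'
    simp only [V, mem_degreeLT, ← hd₁] at ha
    have ha0 : a = 0 := by
      refine eq_zero_of_dvd_of_degree_lt (dvd_of_sq_dvd_mul_wronskian h₁ hS ⟨-b, ?_⟩) ha
      linear_combination (-Q₁) * hx' - a * hT
    subst ha0
    have hb0 : b = 0 := by simpa [h₁] using hx'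
    subst hb0
    rfl
  have hsurj : Function.Surjective g := by
    have := hfin
    refine (LinearMap.injective_iff_surjective_of_finrank_eq_finrank ?_).1 hinj
    rw [Module.finrank_prod, hrank, hrank, hrank]
  have hPU : P ∈ U := by
    rwa [mem_degreeLT, Nat.cast_add, ← hd₁, ← hd₂, ← degree_mul]
  obtain ⟨⟨⟨a, ha⟩, ⟨b, hb⟩⟩, hx⟩ := hsurj ⟨P, hPU⟩
  refine ⟨a, b, by rwa [hd₁, ← mem_degreeLT], by rwa [hd₂, ← mem_degreeLT], ?_⟩
  simpa [hx] using hg ⟨⟨a, ha⟩, ⟨b, hb⟩⟩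

end

/-- Ostrogradsky's method of integrating rational functions, in differentiated
(algebraic) form: if `P, Q` are real polynomials with `Q ≠ 0`,
`deg P < deg Q`, and `Q` not squarefree, setting `Q₁ = gcd Q Q'` and
`Q₂ = Q / Q₁`, there are real polynomials `P₁, P₂` with `deg P₁ < deg Q₁` and
`deg P₂ < deg Q₂` such that in `ℝ(x)` one has
`P/Q = (P₁/Q₁)' + P₂/Q₂`, where `(P₁/Q₁)' = (P₁'Q₁ - P₁Q₁')/Q₁²`. -/
theorem ostrogradsky (P Q : Polynomial ℝ) (hQ : Q ≠ 0)
    (hdeg : P.degree < Q.degree) (hsf : ¬ Squarefree Q)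
    (Q₁ Q₂ : Polynomial ℝ)
    (hQ₁ : Q₁ = gcd Q (derivative Q)) (hQ₂ : Q₂ = Q / Q₁) :
    ∃ P₁ P₂ : Polynomial ℝ, P₁.degree < Q₁.degree ∧ P₂.degree < Q₂.degree ∧
      (algebraMap (Polynomial ℝ) (RatFunc ℝ) P) / (algebraMap (Polynomial ℝ) (RatFunc ℝ) Q) =
        (algebraMap (Polynomial ℝ) (RatFunc ℝ) (derivative P₁ * Q₁ - P₁ * derivative Q₁)) /
          (algebraMap (Polynomial ℝ) (RatFunc ℝ) (Q₁ ^ 2)) +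
        (algebraMap (Polynomial ℝ) (RatFunc ℝ) P₂) / (algebraMap (Polynomial ℝ) (RatFunc ℝ) Q₂) := by
  have hd : Q₁ ∣ Q := hQ₁ ▸ gcd_dvd_left _ _
  have hd' : Q₁ ∣ derivative Q := hQ₁ ▸ gcd_dvd_right _ _
  have h₁ : Q₁ ≠ 0 := ne_zero_of_dvd_ne_zero hQ hd
  have hmul : Q₁ * Q₂ = Q := hQ₂ ▸ EuclideanDomain.mul_div_cancel' h₁ hd
  have hS : Squarefree Q₂ := squarefree_of_mul_eq_of_dvd hQ hmul fun d h h' =>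
    hQ₁ ▸ dvd_gcd h h'
  obtain ⟨T, hT⟩ : Q₁ ∣ derivative Q₁ * Q₂ := by
    rw [← hmul, derivative_mul] at hd'
    exact (dvd_add_left (dvd_mul_right _ _)).1 hd'
  obtain ⟨P₁, P₂, hP₁, hP₂, rfl⟩ := exists_hermite_reduction h₁ hS hT (hmul.symm ▸ hdeg)
  refine ⟨P₁, P₂, hP₁, hP₂, ?_⟩
  have h₁' : algebraMap ℝ[X] (RatFunc ℝ) Q₁ ≠ 0 := RatFunc.algebraMap_ne_zero h₁
  have h₂' : algebraMap ℝ[X] (RatFunc ℝ) Q₂ ≠ 0 := RatFunc.algebraMap_ne_zero hS.ne_zero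
  have hT' := congrArg (algebraMap ℝ[X] (RatFunc ℝ)) hT
  rw [← hmul]
  simp only [map_mul, map_add, map_sub, map_pow] at hT' ⊢
  field_simp
  linear_combination algebraMap ℝ[X] (RatFunc ℝ) P₁ * hT'
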